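/- arXiv:1111.1592 — 3 statements merged into one kernel-verified Lean document; each statement's English description precedes it below -/
import Mathlib

section
/- Let A be an irreducible square non-negative integer matrix that is not a permutation matrix (as holds when the graph C*-algebra C*(G_A) is purely infinite simple). Then there exists N ∈ ℕ such that for all n > N there is an n×n integer matrix B with every entry strictly positive, such that A ∼_M I + B and det(I − A) = det(−B). -/
/-- A directed graph as used in the theory of graph `C*`-algebras:
a type of vertices, a type of edges, and range and source maps. -/
structure CKGraph : Type 1 where
  V : Type
  E : Type
  r : E → V
  s : E → V

namespace CKGraph

/-- An isomorphism of graphs: bijections of vertices and edges intertwining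
the range and source maps. -/
structure Iso (G H : CKGraph) where
  vEquiv : G.V ≃ H.V
  eEquiv : G.E ≃ H.E
  map_r : ∀ e, H.r (eEquiv e) = vEquiv (G.r e)
  map_s : ∀ e, H.s (eEquiv e) = vEquiv (G.s e)

/-- A vertex is a source if it receives no edges. -/
def IsSource (G : CKGraph) (v : G.V) : Prop := ∀ e, G.r e ≠ v

/-- A vertex is a sink if it emits no edges. -/
def IsSink (G : CKGraph) (v : G.V) : Prop := ∀ e, G.s e ≠ v

/-- A vertex is an infinite emitter if it emits infinitely many edges. -/
def IsInfiniteEmitter (G : CKGraph) (v : G.V) : Prop := {e | G.s e = v}.Infinite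

/-- A vertex is regular if it is neither a sink nor an infinite emitter. -/
def Regular (G : CKGraph) (v : G.V) : Prop :=
  (∃ e, G.s e = v) ∧ {e | G.s e = v}.Finite

/-- There is a (nonempty) path from `u` to `v` in `G`. -/
inductive HasPath (G : CKGraph) : G.V → G.V → Prop
  | single (e : G.E) : HasPath G (G.s e) (G.r e)
  | cons (e : G.E) {v : G.V} : HasPath G (G.r e) v → HasPath G (G.s e) v

/-- `G.Geq u v` is the relation `u ≥ v`: `u = v` or there is a path from `u` to `v`. -/
def Geq (G : CKGraph) (u v : G.V) : Prop := u = v ∨ G.HasPath u v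

/-- There is a (nonempty) path from `u` to `v` all of whose vertices lie in `S`. -/
inductive HasPathIn (G : CKGraph) (S : Set G.V) : G.V → G.V → Prop
  | single (e : G.E) : G.s e ∈ S → G.r e ∈ S → HasPathIn G S (G.s e) (G.r e)
  | cons (e : G.E) {v : G.V} : G.s e ∈ S → HasPathIn G S (G.r e) v →
      HasPathIn G S (G.s e) v

/-- The nonempty list of edges `l` is a path from `u` to `v`. -/
def IsPathFromTo (G : CKGraph) (l : List G.E) (u v : G.V) : Prop :=
  ∃ h : l ≠ [], l.Chain' (fun e f => G.r e = G.s f) ∧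
    G.s (l.head h) = u ∧ G.r (l.getLast h) = v

/-- The list of edges `l` is a simple loop based at `v`: a loop at `v` such that the
range of every non-final edge is different from `v`. -/
def IsSimpleLoopAt (G : CKGraph) (v : G.V) (l : List G.E) : Prop :=
  G.IsPathFromTo l v v ∧ ∀ e ∈ l.dropLast, G.r e ≠ v

/-- A set of vertices is hereditary if it contains the range of every edge whose
source it contains. -/
def Hereditary (G : CKGraph) (H : Set G.V) : Prop := ∀ e, G.s e ∈ H → G.r e ∈ H

/-- A set of vertices is saturated if it contains every regular vertex all of whose
emitted edges have range in the set. -/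
def Saturated (G : CKGraph) (H : Set G.V) : Prop :=
  ∀ v, G.Regular v → (∀ e, G.s e = v → G.r e ∈ H) → v ∈ H

/-- Move (S): removing the (regular) source `v` together with all edges it emits. -/
def removeSource (G : CKGraph) (v : G.V) (hsrc : G.IsSource v) : CKGraph where
  V := {w : G.V // w ≠ v}
  E := {e : G.E // G.s e ≠ v}
  r e := ⟨G.r e.1, hsrc e.1⟩
  s e := ⟨G.s e.1, e.2⟩

/-- Move (R): the reduction at a vertex `u` that emits exactly one edge `f` with
`r f ≠ u` and receives only from the single vertex `v`. -/
def reduce (G : CKGraph) (u : G.V) (f : G.E) (hf : G.s f = u) (hrf : G.r f ≠ u)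
    (honly : ∀ e, G.s e = u → e = f) (v : G.V) (hin : ∀ e, G.r e = u → G.s e = v) :
    CKGraph where
  V := {w : G.V // w ≠ u}
  E := {e : G.E // G.r e ≠ u ∧ e ≠ f} ⊕ {e : G.E // G.r e = u}
  r x :=
    match x with
    | .inl e => ⟨G.r e.1, e.2.1⟩
    | .inr _ => ⟨G.r f, hrf⟩
  s x :=
    match x with
    | .inl e => ⟨G.s e.1, fun h => e.2.2 (honly e.1 h)⟩
    | .inr e => ⟨G.s e.1, by
        intro h
        have h2 : G.r e.1 = u := e.2
        rw [honly e.1 h] at h2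
        exact hrf h2⟩

/-- Move (O): the out-split of `G` at `v` according to the partition of `s⁻¹(v)`
into the fibres of `P`. -/
noncomputable def outSplit (G : CKGraph) (v : G.V) (n : ℕ)
    (P : {e : G.E // G.s e = v} → Fin n) : CKGraph :=
  letI := Classical.decEq G.V
  { V := {w : G.V // w ≠ v} ⊕ Fin n
    E := {e : G.E // G.r e ≠ v} ⊕ ({e : G.E // G.r e = v} × Fin n)
    r := fun x =>
      match x with
      | .inl e => Sum.inl ⟨G.r e.1, e.2⟩
      | .inr p => Sum.inr p.2
    s := fun x =>
      match x with
      | .inl e =>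
          if h : G.s e.1 = v then Sum.inr (P ⟨e.1, h⟩) else Sum.inl ⟨G.s e.1, h⟩
      | .inr p =>
          if h : G.s p.1.1 = v then Sum.inr (P ⟨p.1.1, h⟩)
          else Sum.inl ⟨G.s p.1.1, h⟩ }

/-- Move (I): the in-split of `G` at `v` according to the partition of `r⁻¹(v)`
into the fibres of `P`. -/
noncomputable def inSplit (G : CKGraph) (v : G.V) (n : ℕ)
    (P : {e : G.E // G.r e = v} → Fin n) : CKGraph :=
  letI := Classical.decEq G.V
  { V := {w : G.V // w ≠ v} ⊕ Fin n
    E := {e : G.E // G.s e ≠ v} ⊕ ({e : G.E // G.s e = v} × Fin n)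
    s := fun x =>
      match x with
      | .inl e => Sum.inl ⟨G.s e.1, e.2⟩
      | .inr p => Sum.inr p.2
    r := fun x =>
      match x with
      | .inl e =>
          if h : G.r e.1 = v then Sum.inr (P ⟨e.1, h⟩) else Sum.inl ⟨G.r e.1, h⟩
      | .inr p =>
          if h : G.r p.1.1 = v then Sum.inr (P ⟨p.1.1, h⟩)
          else Sum.inl ⟨G.r p.1.1, h⟩ }

/-- Move-equivalence: the smallest equivalence relation on graphs with finitely many
vertices such that `G ∼ H` whenever `H` is obtained from `G`, up to graph
isomorphism, by one of the moves (S), (I), (O), (R). -/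
inductive MoveEquiv : CKGraph → CKGraph → Prop
  | of_iso {G H : CKGraph} (hG : Finite G.V) (h : Nonempty (Iso G H)) : MoveEquiv G H
  | moveS {G : CKGraph} (hG : Finite G.V) (v : G.V) (hreg : G.Regular v)
      (hsrc : G.IsSource v) {H : CKGraph}
      (h : Nonempty (Iso H (G.removeSource v hsrc))) : MoveEquiv G H
  | moveR {G : CKGraph} (hG : Finite G.V) (u : G.V) (f : G.E) (hf : G.s f = u)
      (hrf : G.r f ≠ u) (honly : ∀ e, G.s e = u → e = f) (v : G.V)
      (hin : ∀ e, G.r e = u → G.s e = v) {H : CKGraph}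
      (h : Nonempty (Iso H (G.reduce u f hf hrf honly v hin))) : MoveEquiv G H
  | moveO {G : CKGraph} (hG : Finite G.V) (v : G.V) (hns : ¬ G.IsSink v) (n : ℕ)
      (P : {e : G.E // G.s e = v} → Fin n) (hsurj : Function.Surjective P)
      (hinf : ∀ i j : Fin n, {x : {e : G.E // G.s e = v} | P x = i}.Infinite →
        {x : {e : G.E // G.s e = v} | P x = j}.Infinite → i = j)
      {H : CKGraph} (h : Nonempty (Iso H (G.outSplit v n P))) : MoveEquiv G H
  | moveI {G : CKGraph} (hG : Finite G.V) (v : G.V) (hreg : G.Regular v)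
      (hns : ¬ G.IsSource v) (n : ℕ) (P : {e : G.E // G.r e = v} → Fin n)
      (hsurj : Function.Surjective P) {H : CKGraph}
      (h : Nonempty (Iso H (G.inSplit v n P))) : MoveEquiv G H
  | symm {G H : CKGraph} : MoveEquiv G H → MoveEquiv H G
  | trans {G H K : CKGraph} : MoveEquiv G H → MoveEquiv H K → MoveEquiv G K

/-- The graph obtained from `G` by collapsing a regular non-source vertex `v` that
emits exactly one edge `f₀`, which is not a loop: delete `v`, `f₀` and all edges into
`v`, and add an edge `[e f₀]` from `s e` to `r f₀` for every edge `e` into `v`. -/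
def collapseOne (G : CKGraph) (v : G.V) (f₀ : G.E) (hf : G.s f₀ = v)
    (honly : ∀ e, G.s e = v → e = f₀) (hr : G.r f₀ ≠ v) : CKGraph where
  V := {w : G.V // w ≠ v}
  E := {e : G.E // G.r e ≠ v ∧ e ≠ f₀} ⊕ {e : G.E // G.r e = v}
  r x :=
    match x with
    | .inl e => ⟨G.r e.1, e.2.1⟩
    | .inr _ => ⟨G.r f₀, hr⟩
  s x :=
    match x with
    | .inl e => ⟨G.s e.1, fun h => e.2.2 (honly e.1 h)⟩
    | .inr e => ⟨G.s e.1, by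
        intro h
        have h2 : G.r e.1 = v := e.2
        rw [honly e.1 h] at h2
        exact hr h2⟩

/-- The graph obtained from `G` by collapsing a regular vertex `v` which does not
support a loop of length one: delete `v` and all edges into or out of `v`, and add
an edge `[e f]` from `s e` to `r f` for every pair of edges `e, f` with
`r e = v = s f`. -/
def collapse (G : CKGraph) (v : G.V) (hnl : ∀ e, G.s e = v → G.r e ≠ v) :
    CKGraph where
  V := {w : G.V // w ≠ v}
  E := {e : G.E // G.r e ≠ v ∧ G.s e ≠ v} ⊕
    ({e : G.E // G.r e = v} × {f : G.E // G.s f = v})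
  s x :=
    match x with
    | .inl e => ⟨G.s e.1, e.2.2⟩
    | .inr p => ⟨G.s p.1.1, fun h => hnl p.1.1 h p.1.2⟩
  r x :=
    match x with
    | .inl e => ⟨G.r e.1, e.2.1⟩
    | .inr p => ⟨G.r p.2.1, fun h => hnl p.2.1 p.2.2 h⟩

/-- The graph obtained from `G` by adding countably infinitely many new edges,
each with source `u` and range `w`. -/
def addEdges (G : CKGraph) (u w : G.V) : CKGraph where
  V := G.V
  E := G.E ⊕ ℕ
  r x := match x with | .inl e => G.r e | .inr _ => w
  s x := match x with | .inl e => G.s e | .inr _ => u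

/-- The graph with exactly one vertex and no edges. -/
def singletonGraph : CKGraph where
  V := PUnit
  E := Empty
  r e := e.elim
  s e := e.elim

/-- The Cuntz splice of `G` at `v`: add two new vertices `u₁, u₂` and six new edges:
`v → u₁`, `u₁ → v`, a loop at `u₁`, `u₁ → u₂`, `u₂ → u₁`, and a loop at `u₂`. -/
def cuntzSplice (G : CKGraph) (v : G.V) : CKGraph where
  V := G.V ⊕ Fin 2
  E := G.E ⊕ Fin 6
  s x :=
    match x with
    | .inl e => Sum.inl (G.s e)
    | .inr i => ![Sum.inl v, Sum.inr 0, Sum.inr 0, Sum.inr 0, Sum.inr 1, Sum.inr 1] i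
  r x :=
    match x with
    | .inl e => Sum.inl (G.r e)
    | .inr i => ![Sum.inr 0, Sum.inl v, Sum.inr 0, Sum.inr 1, Sum.inr 0, Sum.inr 1] i

/-- The adjacency matrix (as an integer matrix) of a graph whose vertices are
enumerated by `Fin n`. -/
noncomputable def adjMatrix (G : CKGraph) {n : ℕ} (ρ : G.V ≃ Fin n) :
    Matrix (Fin n) (Fin n) ℤ :=
  Matrix.of fun i j => (Nat.card {e : G.E // G.s e = ρ.symm i ∧ G.r e = ρ.symm j} : ℤ)

end CKGraph

/-- The graph of an `ℕ∞`-valued square matrix: it has exactly `A x y` edges from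
`x` to `y`. -/
def graphOfMatrix {n : ℕ} (A : Matrix (Fin n) (Fin n) ℕ∞) : CKGraph where
  V := Fin n
  E := Σ x : Fin n, Σ y : Fin n, {k : ℕ // (k : ℕ∞) < A x y}
  s e := e.1
  r e := e.2.1

/-- Move-equivalence of (possibly differently sized) square matrices over `ℕ∞`. -/
def MatMoveEquiv {m n : ℕ} (A : Matrix (Fin m) (Fin m) ℕ∞)
    (B : Matrix (Fin n) (Fin n) ℕ∞) : Prop :=
  CKGraph.MoveEquiv (graphOfMatrix A) (graphOfMatrix B)

/-- A square matrix is irreducible if any index connects to any other index through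
a chain of non-zero entries. -/
def MatIrreducible {n : ℕ} {α : Type*} [Zero α] (A : Matrix (Fin n) (Fin n) α) :
    Prop :=
  ∀ i j : Fin n, ∃ (l : ℕ) (c : ℕ → Fin n), 1 ≤ l ∧ c 0 = i ∧ c l = j ∧
    ∀ t < l, A (c t) (c (t + 1)) ≠ 0

/-- `Jmat n m` is the `n × n` matrix whose top-left `m × m` block is the identity,
whose other entries in the first `m` rows are `0`, and whose last `n - m` rows have
every entry equal to `∞`. -/
def Jmat (n m : ℕ) : Matrix (Fin n) (Fin n) ℕ∞ :=
  Matrix.of fun i j => if i.1 < m then (if i = j then 1 else 0) else ⊤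

namespace CKGraph

/-- The number of edges from `x` to `y` (zero if there are infinitely many). -/
noncomputable def edgeCount (G : CKGraph) (x y : G.V) : ℕ :=
  Nat.card {e : G.E // G.s e = x ∧ G.r e = y}

theorem nonempty_iso_of_edgeCount {G H : CKGraph} [Finite G.E] [Finite H.E] (φ : G.V ≃ H.V)
    (h : ∀ x y, G.edgeCount x y = H.edgeCount (φ x) (φ y)) : Nonempty (Iso G H) := by
  have key : ∀ p : H.V × H.V, Nonempty ({e : G.E // (φ (G.s e), φ (G.r e)) = p} ≃
      {e : H.E // (H.s e, H.r e) = p}) := by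
    rintro ⟨x, y⟩
    refine Finite.card_eq.1 ?_
    have := h (φ.symm x) (φ.symm y)
    simpa [edgeCount, Prod.ext_iff, Equiv.eq_symm_apply] using this
  let F := Equiv.ofFiberEquiv fun p => (key p).some
  have hF : ∀ e, (H.s (F e), H.r (F e)) = (φ (G.s e), φ (G.r e)) := fun e =>
    Equiv.ofFiberEquiv_map (g := fun e => (H.s e, H.r e)) (fun p => (key p).some) e
  exact ⟨⟨φ, F, fun e => (Prod.ext_iff.1 (hF e)).2, fun e => (Prod.ext_iff.1 (hF e)).1⟩⟩

/-- The opposite graph, in which all edges are reversed. -/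
def op (G : CKGraph) : CKGraph where
  V := G.V
  E := G.E
  r := G.s
  s := G.r

theorem Iso.trans {G H K : CKGraph} (i : Iso G H) (j : Iso H K) : Nonempty (Iso G K) :=
  ⟨⟨i.vEquiv.trans j.vEquiv, i.eEquiv.trans j.eEquiv,
    fun e => by simp [j.map_r, i.map_r], fun e => by simp [j.map_s, i.map_s]⟩⟩

theorem Iso.op {G H : CKGraph} (i : Iso G H) : Nonempty (Iso G.op H.op) :=
  ⟨⟨i.vEquiv, i.eEquiv, i.map_s, i.map_r⟩⟩

theorem nonempty_iso_op_outSplit (G : CKGraph) (v : G.V) (n : ℕ)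
    (P : {e : G.E // G.s e = v} → Fin n) :
    Nonempty (Iso (G.outSplit v n P).op (G.op.inSplit v n P)) :=
  ⟨⟨Equiv.refl _, Equiv.refl _, by rintro (e | e) <;> rfl, by rintro (e | e) <;> rfl⟩⟩

/-- The graph with vertex set `X` having, for each `i : P`, exactly `T i y` edges
from `p i` to `y` labelled by `i`. -/
def ofRows {P X : Type} (p : P → X) (T : P → X → ℕ) : CKGraph where
  V := X
  E := Σ i : P, Σ y : X, Fin (T i y)
  s e := p e.1
  r e := e.2.1

/-- The graph with `A x y` edges from `x` to `y`. -/
def ofNatMatrix {X : Type} (A : Matrix X X ℕ) : CKGraph := ofRows id fun x y => A x y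

instance {P X : Type} [Finite P] [Finite X] (p : P → X) (T : P → X → ℕ) :
    Finite (ofRows p T).E :=
  inferInstanceAs (Finite (Σ i : P, Σ y : X, Fin (T i y)))

instance {P X : Type} [Finite X] (p : P → X) (T : P → X → ℕ) :
    Finite (ofRows p T).V := ‹Finite X›

instance {X : Type} [Finite X] (A : Matrix X X ℕ) : Finite (ofNatMatrix A).E :=
  inferInstanceAs (Finite (ofRows id fun x y => A x y).E)

instance {X : Type} [Finite X] (A : Matrix X X ℕ) : Finite (ofNatMatrix A).V := ‹Finite X›

instance (G : CKGraph) [h : Finite G.E] : Finite G.op.E := h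

instance (G : CKGraph) [h : Finite G.V] : Finite G.op.V := h

/-- The edges of `ofRows p T` labelled by `i` with range `y` are indexed by `Fin (T i y)`. -/
noncomputable def labelEquiv {P X : Type} (p : P → X) (T : P → X → ℕ) (i : P) (y : X) :
    Fin (T i y) ≃ {e : (ofRows p T).E // e.1 = i ∧ (ofRows p T).r e = y} :=
  Equiv.ofBijective (fun k => ⟨⟨i, y, k⟩, rfl, rfl⟩)
    ⟨fun k l h => by simpa [ofRows] using congrArg Subtype.val h,
      by rintro ⟨⟨_, _, k⟩, rfl, rfl⟩; exact ⟨k, rfl⟩⟩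

theorem card_ofRows_label {P X : Type} (p : P → X) (T : P → X → ℕ) (i : P) (y : X) :
    Nat.card {e : (ofRows p T).E // e.1 = i ∧ (ofRows p T).r e = y} = T i y := by
  rw [← Nat.card_congr (labelEquiv p T i y), Nat.card_fin]

theorem edgeCount_ofNatMatrix {X : Type} (A : Matrix X X ℕ) (x y : X) :
    (ofNatMatrix A).edgeCount x y = A x y := card_ofRows_label id (fun x y => A x y) x y

theorem edgeCount_op (G : CKGraph) (x y : G.V) : G.op.edgeCount x y = G.edgeCount y x := by
  refine Nat.card_congr (Equiv.subtypeEquivRight fun e => ?_)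
  exact and_comm

theorem nonempty_iso_op_ofNatMatrix {X : Type} [Finite X] (A : Matrix X X ℕ) :
    Nonempty (Iso (ofNatMatrix A).op (ofNatMatrix A.transpose)) :=
  nonempty_iso_of_edgeCount (Equiv.refl X) fun x y =>
    (edgeCount_op (ofNatMatrix A) x y).trans <|
      (edgeCount_ofNatMatrix A y x).trans (edgeCount_ofNatMatrix A.transpose x y).symm

theorem edgeCount_ofRows {P X : Type} [Fintype P] [DecidableEq X] (p : P → X)
    (T : P → X → ℕ) (x y : X) :
    (ofRows p T).edgeCount x y = ∑ i, if p i = x then T i y else 0 := by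
  have e : {e : (ofRows p T).E // (ofRows p T).s e = x ∧ (ofRows p T).r e = y} ≃
      Σ i : {i // p i = x}, {e : (ofRows p T).E // e.1 = i ∧ (ofRows p T).r e = y} :=
    { toFun := fun e => ⟨⟨e.1.1, e.2.1⟩, e.1, rfl, e.2.2⟩
      invFun := fun e => ⟨e.2.1, by
        have h1 := e.2.2.1
        have h2 := e.1.2
        rw [← h1] at h2
        exact h2, e.2.2.2⟩
      left_inv := fun e => rfl
      right_inv := by
        rintro ⟨⟨i, hi⟩, e, h, h'⟩
        dsimp only at h
        subst h
        rfl }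
  have hf : ∀ i : {i // p i = x},
      Finite {e : (ofRows p T).E // e.1 = i.1 ∧ (ofRows p T).r e = y} := fun i =>
    Finite.of_equiv _ (labelEquiv p T i.1 y)
  refine (Nat.card_congr e).trans ?_
  rw [Nat.card_sigma]
  simp only [card_ofRows_label]
  rw [← Finset.sum_filter]
  exact (Finset.sum_subtype _ (by simp) (fun i => T i y)).symm

/-- The projection of the vertices of an out-split onto the original vertices. -/
def splitProj {X : Type} (v : X) (n : ℕ) : {w : X // w ≠ v} ⊕ Fin n → X :=
  Sum.elim Subtype.val fun _ => v

theorem edgeCount_outSplit (G : CKGraph) (v : G.V) (n : ℕ)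
    (P : {e : G.E // G.s e = v} → Fin n) (σ : G.E → {w : G.V // w ≠ v} ⊕ Fin n)
    (h₁ : ∀ e h, σ e = Sum.inr (P ⟨e, h⟩)) (h₂ : ∀ e h, σ e = Sum.inl ⟨G.s e, h⟩)
    (x y : {w : G.V // w ≠ v} ⊕ Fin n) :
    (G.outSplit v n P).edgeCount x y =
      Nat.card {e : G.E // σ e = x ∧ G.r e = splitProj v n y} := by
  have hl : ∀ e, (G.outSplit v n P).s (Sum.inl e) = σ e.1 := fun e => by
    by_cases h : G.s e.1 = v
    · rw [h₁ _ h]; simp [outSplit, h]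
    · rw [h₂ _ h]; simp [outSplit, h]
  have hr : ∀ p, (G.outSplit v n P).s (Sum.inr p) = σ p.1.1 := fun e => by
    by_cases h : G.s e.1.1 = v
    · rw [h₁ _ h]; simp [outSplit, h]
    · rw [h₂ _ h]; simp [outSplit, h]
  refine (Nat.card_congr ?_).symm
  rcases y with y | j
  · exact
      { toFun := fun e => ⟨Sum.inl ⟨e.1, fun h => y.2 (e.2.2.symm.trans h)⟩,
          (hl _).trans e.2.1, congrArg Sum.inl (Subtype.ext e.2.2)⟩
        invFun := fun e => match e with
          | ⟨Sum.inl e, h⟩ => ⟨e.1, (hl e).symm.trans h.1,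
              congrArg Subtype.val (Sum.inl_injective h.2)⟩
          | ⟨Sum.inr e, h⟩ => (Sum.inr_ne_inl h.2).elim
        left_inv := fun e => rfl
        right_inv := by
          rintro ⟨e | e, h⟩
          · rfl
          · exact (Sum.inr_ne_inl h.2).elim }
  · exact
      { toFun := fun e => ⟨Sum.inr ⟨⟨e.1, e.2.2⟩, j⟩, (hr _).trans e.2.1, rfl⟩
        invFun := fun e => match e with
          | ⟨Sum.inr e, h⟩ => ⟨e.1.1, (hr e).symm.trans h.1, e.1.2⟩
          | ⟨Sum.inl e, h⟩ => (Sum.inl_ne_inr h.2).elim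
        left_inv := fun e => rfl
        right_inv := by
          rintro ⟨e | e, h⟩
          · exact (Sum.inl_ne_inr h.2).elim
          · have : e.2 = j := Sum.inr_injective h.2
            subst this
            rfl }

/-- The projection `X ⊕ Unit → X` sending the extra point to `v`. -/
def fold {X : Type} (v : X) : X ⊕ Unit → X := Sum.elim id fun _ => v

/-- Doubling the point `v` of `X`, either by adding one point or by replacing `v`
by two points. -/
def doubleEquiv {X : Type} [DecidableEq X] (v : X) : X ⊕ Unit ≃ {w : X // w ≠ v} ⊕ Fin 2 where
  toFun := Sum.elim (fun x => if h : x = v then Sum.inr 0 else Sum.inl ⟨x, h⟩)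
    fun _ => Sum.inr 1
  invFun := Sum.elim (fun w => Sum.inl w.1) ![Sum.inl v, Sum.inr ()]
  left_inv := by
    rintro (x | x)
    · by_cases h : x = v <;> simp [h]
    · simp
  right_inv := by
    rintro (w | i)
    · simp [w.2]
    · fin_cases i <;> simp

theorem splitProj_doubleEquiv {X : Type} [DecidableEq X] (v : X) (x : X ⊕ Unit) :
    splitProj v 2 (doubleEquiv v x) = fold v x := by
  rcases x with x | x
  · by_cases h : x = v <;> simp [h, splitProj, doubleEquiv, fold]
  · simp [splitProj, doubleEquiv, fold]

/-- The labelling of the edges of `ofRows (fold v) T` emitted by `v`. -/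
def splitLabel {X : Type} (v : X) (T : X ⊕ Unit → X → ℕ)
    (e : {e : (ofRows (fold v) T).E // (ofRows (fold v) T).s e = v}) : Fin 2 :=
  Sum.elim (fun _ => 0) (fun _ => 1) e.1.1

/-- The matrix obtained by amalgamating the extra row of `T` with the row `v`. -/
def amalgamateRow {X : Type} [DecidableEq X] (v : X) (T : X ⊕ Unit → X → ℕ) :
    Matrix X X ℕ :=
  Matrix.of fun x y => T (Sum.inl x) y + if x = v then T (Sum.inr ()) y else 0

/-- The matrix obtained from `T` by duplicating the column `v`. -/
def duplicateCol {X : Type} (v : X) (T : X ⊕ Unit → X → ℕ) :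
    Matrix (X ⊕ Unit) (X ⊕ Unit) ℕ :=
  Matrix.of fun x y => T x (fold v y)

theorem nonempty_iso_ofRows {X : Type} [Fintype X] [DecidableEq X] (v : X)
    (T : X ⊕ Unit → X → ℕ) :
    Nonempty (Iso (ofNatMatrix (amalgamateRow v T)) (ofRows (fold v) T)) :=
  nonempty_iso_of_edgeCount (Equiv.refl X) fun (x y : X) => by
    refine (edgeCount_ofNatMatrix _ x y).trans (Eq.trans ?_ (edgeCount_ofRows _ T x y).symm)
    simp [amalgamateRow, fold, @eq_comm _ v x]
    exact ((Finset.sum_ite_eq' Finset.univ x fun i => T (Sum.inl i) y).trans (by simp)).symm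

theorem nonempty_iso_outSplit {X : Type} [Fintype X] [DecidableEq X] (v : X)
    (T : X ⊕ Unit → X → ℕ) :
    Nonempty (Iso (ofNatMatrix (duplicateCol v T))
      ((ofRows (fold v) T).outSplit v 2 (splitLabel v T))) := by
  have : Finite ((ofRows (fold v) T).outSplit v 2 (splitLabel v T)).E := by
    unfold outSplit; dsimp only; infer_instance
  refine nonempty_iso_of_edgeCount (doubleEquiv v) fun x y => ?_
  refine (edgeCount_ofNatMatrix _ x y).trans ?_
  refine Eq.trans ?_ (edgeCount_outSplit _ _ _ _
    (fun e : (ofRows (fold v) T).E => doubleEquiv v e.1) ?_ ?_ _ _).symm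
  · refine (card_ofRows_label (fold v) T x (fold v y)).symm.trans
      (Nat.card_congr (Equiv.subtypeEquivRight fun e => ?_))
    exact and_congr (EmbeddingLike.apply_eq_iff_eq _).symm
      (by erw [← splitProj_doubleEquiv]; rfl)
  · rintro ⟨x | x, y, k⟩ h
    · have : x = v := h
      simp [doubleEquiv, splitLabel, this]; rfl
    · simp [doubleEquiv, splitLabel]; rfl
  · rintro ⟨x | x, y, k⟩ h
    · have : x ≠ v := h
      simp [doubleEquiv, this, ofRows, fold]
    · exact (h rfl).elim

theorem splitLabel_surjective {X : Type} (v : X) (T : X ⊕ Unit → X → ℕ)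
    (h₀ : ∃ y, T (Sum.inl v) y ≠ 0) (h₁ : ∃ y, T (Sum.inr ()) y ≠ 0) :
    Function.Surjective (splitLabel v T) := by
  obtain ⟨y, hy⟩ := h₀
  obtain ⟨z, hz⟩ := h₁
  intro i
  fin_cases i
  · exact ⟨⟨⟨Sum.inl v, y, ⟨0, Nat.pos_of_ne_zero hy⟩⟩, rfl⟩, rfl⟩
  · exact ⟨⟨⟨Sum.inr (), z, ⟨0, Nat.pos_of_ne_zero hz⟩⟩, rfl⟩, rfl⟩

theorem moveEquiv_duplicateCol {X : Type} [Fintype X] [DecidableEq X] (v : X)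
    (T : X ⊕ Unit → X → ℕ)
    (h₀ : ∃ y, T (Sum.inl v) y ≠ 0) (h₁ : ∃ y, T (Sum.inr ()) y ≠ 0) :
    MoveEquiv (ofNatMatrix (amalgamateRow v T)) (ofNatMatrix (duplicateCol v T)) := by
  refine (MoveEquiv.of_iso inferInstance (nonempty_iso_ofRows v T)).trans
    (MoveEquiv.moveO inferInstance v ?_ 2 _ (splitLabel_surjective v T h₀ h₁) ?_
      (nonempty_iso_outSplit v T))
  · obtain ⟨y, hy⟩ := h₀
    exact fun h => h ⟨Sum.inl v, y, ⟨0, Nat.pos_of_ne_zero hy⟩⟩ rfl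
  · exact fun i j h => (h (Set.toFinite _)).elim

theorem moveEquiv_duplicateCol_transpose {X : Type} [Fintype X] [DecidableEq X] (v : X)
    (T : X ⊕ Unit → X → ℕ)
    (h₀ : ∃ y, T (Sum.inl v) y ≠ 0) (h₁ : ∃ y, T (Sum.inr ()) y ≠ 0)
    (hv : ∃ x, T x v ≠ 0) :
    MoveEquiv (ofNatMatrix (amalgamateRow v T).transpose)
      (ofNatMatrix (duplicateCol v T).transpose) := by
  have i₁ : MoveEquiv (ofNatMatrix (amalgamateRow v T).transpose) (ofRows (fold v) T).op :=
    (MoveEquiv.of_iso (G := (ofNatMatrix (amalgamateRow v T)).op) inferInstance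
      (nonempty_iso_op_ofNatMatrix _)).symm.trans
      (MoveEquiv.of_iso inferInstance (nonempty_iso_ofRows v T).some.op)
  have i₂ := MoveEquiv.of_iso inferInstance (nonempty_iso_op_ofNatMatrix (duplicateCol v T))
  refine (i₁.trans (MoveEquiv.moveI (G := (ofRows (fold v) T).op) inferInstance v ?_ ?_ 2
    (splitLabel v T) (splitLabel_surjective v T h₀ h₁)
    ((nonempty_iso_outSplit v T).some.op.some.trans
      (nonempty_iso_op_outSplit (ofRows (fold v) T) v 2 (splitLabel v T)).some))).trans i₂
  · obtain ⟨x, hx⟩ := hv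
    exact ⟨⟨⟨x, v, ⟨0, Nat.pos_of_ne_zero hx⟩⟩, rfl⟩, Set.toFinite _⟩
  · obtain ⟨y, hy⟩ := h₀
    exact fun h => h ⟨Sum.inl v, y, ⟨0, Nat.pos_of_ne_zero hy⟩⟩ rfl

/-- The matrix on `X ⊕ Unit` with corner `A` whose extra vertex emits `r y` edges to
each `y : X`, receives `c x` edges from each `x : X`, and supports no loop. -/
def addVertex {X : Type} (A : Matrix X X ℕ) (c r : X → ℕ) : Matrix (X ⊕ Unit) (X ⊕ Unit) ℕ :=
  Matrix.fromBlocks A (Matrix.replicateCol Unit c) (Matrix.replicateRow Unit r) 0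

/-- The vertices of `X ⊕ Unit` other than the extra one. -/
def inlEquiv (X : Type) : X ≃ {z : X ⊕ Unit // z ≠ Sum.inr ()} where
  toFun x := ⟨Sum.inl x, Sum.inl_ne_inr⟩
  invFun z := match z with
    | ⟨Sum.inl x, _⟩ => x
    | ⟨Sum.inr _, h⟩ => (h rfl).elim
  left_inv _ := rfl
  right_inv := by
    rintro ⟨x | x, h⟩
    · rfl
    · exact (h rfl).elim

theorem moveEquiv_addVertex_of_support {X : Type} [Finite X] [DecidableEq X] (A : Matrix X X ℕ)
    (c : X → ℕ) (a w : X) (hc : ∀ x, c x ≠ 0 → x = a) :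
    MoveEquiv (ofNatMatrix (addVertex A c (Pi.single w 1)))
      (ofNatMatrix (A + Matrix.vecMulVec c (Pi.single w 1))) := by
  set M := addVertex A c (Pi.single w 1) with hM
  let G := ofNatMatrix M
  let f : G.E := ⟨Sum.inr (), Sum.inl w, ⟨0, by simp [hM, addVertex]⟩⟩
  have hrf : G.r f ≠ Sum.inr () := Sum.inl_ne_inr
  have honly : ∀ e, G.s e = Sum.inr () → e = f := by
    rintro ⟨x, y | y, k⟩ h
    · obtain rfl : x = Sum.inr () := h
      have hk : k.1 < (Pi.single w 1 : X → ℕ) y := k.2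
      by_cases hy : y = w
      · subst hy
        simp only [Pi.single_eq_same, Nat.lt_one_iff] at hk
        obtain ⟨k, hk'⟩ := k
        obtain rfl : k = 0 := hk
        rfl
      · simp [hy] at hk
    · obtain rfl : x = Sum.inr () := h
      exact (Nat.not_lt_zero _ k.2).elim
  have hin : ∀ e, G.r e = Sum.inr () → G.s e = Sum.inl a := by
    rintro ⟨x | x, y, k⟩ h
    · obtain rfl : y = Sum.inr () := h
      exact congrArg Sum.inl (hc x (Nat.pos_iff_ne_zero.1 (k.1.zero_le.trans_lt k.2)))
    · obtain rfl : y = Sum.inr () := h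
      exact (Nat.not_lt_zero _ k.2).elim
  let K := G.reduce (Sum.inr ()) f rfl hrf honly (Sum.inl a) hin
  have : Finite G.E := inferInstanceAs (Finite (ofNatMatrix M).E)
  have : Finite K.E := inferInstanceAs (Finite ({e : G.E // G.r e ≠ Sum.inr () ∧ e ≠ f} ⊕
    {e : G.E // G.r e = Sum.inr ()}))
  suffices h : Nonempty (Iso (ofNatMatrix (A + Matrix.vecMulVec c (Pi.single w 1))) K) from
    MoveEquiv.moveR (inferInstanceAs (Finite (X ⊕ Unit))) (Sum.inr ()) f rfl hrf honly
      (Sum.inl a) hin h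
  refine nonempty_iso_of_edgeCount (inlEquiv X) fun (x y : X) => ?_
  refine (edgeCount_ofNatMatrix _ x y).trans ?_
  have e₁ : {e : {e : G.E // G.r e ≠ Sum.inr () ∧ e ≠ f} //
      K.s (Sum.inl e) = inlEquiv X x ∧ K.r (Sum.inl e) = inlEquiv X y} ≃
      {e : G.E // G.s e = Sum.inl x ∧ G.r e = Sum.inl y} :=
    { toFun := fun e => ⟨e.1.1, congrArg Subtype.val e.2.1, congrArg Subtype.val e.2.2⟩
      invFun := fun e => ⟨⟨e.1, fun h => Sum.inl_ne_inr (e.2.2.symm.trans h), fun h =>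
        Sum.inl_ne_inr (e.2.1.symm.trans (congrArg G.s h))⟩, Subtype.ext e.2.1,
        Subtype.ext e.2.2⟩
      left_inv := fun e => rfl
      right_inv := fun e => rfl }
  have e₂ : Nat.card {e : {e : G.E // G.r e = Sum.inr ()} //
      K.s (Sum.inr e) = inlEquiv X x ∧ K.r (Sum.inr e) = inlEquiv X y} =
      if y = w then c x else 0 := by
    split_ifs with hy
    · subst hy
      refine Eq.trans (Nat.card_congr ?_) (edgeCount_ofNatMatrix M (Sum.inl x) (Sum.inr ()))
      exact
        { toFun := fun e => ⟨e.1.1, congrArg Subtype.val e.2.1, e.1.2⟩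
          invFun := fun e => ⟨⟨e.1, e.2.2⟩, Subtype.ext e.2.1, rfl⟩
          left_inv := fun e => rfl
          right_inv := fun e => rfl }
    · refine Nat.card_eq_zero.2 (Or.inl ⟨fun e => hy ?_⟩)
      exact (Sum.inl_injective (congrArg Subtype.val e.2.2 : Sum.inl w = Sum.inl y)).symm
  refine Eq.trans ?_ (Nat.card_congr (Equiv.subtypeSum (α := {e : G.E // G.r e ≠ Sum.inr () ∧ e ≠ f})
    (β := {e : G.E // G.r e = Sum.inr ()}) (p := fun e : K.E =>
      K.s e = inlEquiv X x ∧ K.r e = inlEquiv X y))).symm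
  rw [Nat.card_sum, e₂, Nat.card_congr e₁]
  refine Eq.trans ?_ (congrArg (· + if y = w then c x else 0)
    (edgeCount_ofNatMatrix M (Sum.inl x) (Sum.inl y)).symm)
  simp [hM, addVertex, Matrix.vecMulVec_apply, Pi.single_apply]

theorem moveEquiv_submatrix {X Y : Type} [Finite X] [Finite Y] (φ : Y ≃ X) (A : Matrix X X ℕ) :
    MoveEquiv (ofNatMatrix A) (ofNatMatrix (A.submatrix φ φ)) :=
  MoveEquiv.symm <| MoveEquiv.of_iso inferInstance <|
    nonempty_iso_of_edgeCount φ fun (x y : Y) =>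
      (edgeCount_ofNatMatrix _ x y).trans (edgeCount_ofNatMatrix A (φ x) (φ y)).symm

theorem moveEquiv_graphOfMatrix {n : ℕ} (A : Matrix (Fin n) (Fin n) ℕ) :
    MoveEquiv (ofNatMatrix A) (graphOfMatrix (A.map ((↑) : ℕ → ℕ∞))) := by
  let e : (Σ x : Fin n, Σ y : Fin n, Fin (A x y)) ≃
      (Σ x : Fin n, Σ y : Fin n, {k : ℕ // (k : ℕ∞) < A.map ((↑) : ℕ → ℕ∞) x y}) :=
    Equiv.sigmaCongrRight fun x => Equiv.sigmaCongrRight fun y =>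
      Fin.equivSubtype.trans (Equiv.subtypeEquivRight fun k => by simp)
  exact MoveEquiv.of_iso inferInstance
    ⟨⟨Equiv.refl _, e, fun _ => rfl, fun _ => rfl⟩⟩

end CKGraph

open CKGraph

/-- Move-equivalence of the graphs of `A` and `B` together with `det (1 - A) = det (1 - B)`. -/
structure MoveDetEquiv {X Y : Type} [Fintype X] [DecidableEq X] [Fintype Y] [DecidableEq Y]
    (A : Matrix X X ℕ) (B : Matrix Y Y ℕ) : Prop where
  moveEquiv : MoveEquiv (ofNatMatrix A) (ofNatMatrix B)
  det_eq : (1 - A.map ((↑) : ℕ → ℤ)).det = (1 - B.map ((↑) : ℕ → ℤ)).det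

namespace MoveDetEquiv

variable {X Y Z : Type} [Fintype X] [DecidableEq X] [Fintype Y] [DecidableEq Y]
  [Fintype Z] [DecidableEq Z]

theorem refl (A : Matrix X X ℕ) : MoveDetEquiv A A :=
  ⟨MoveEquiv.of_iso inferInstance ⟨⟨Equiv.refl _, Equiv.refl _, fun _ => rfl, fun _ => rfl⟩⟩, rfl⟩

theorem symm {A : Matrix X X ℕ} {B : Matrix Y Y ℕ} (h : MoveDetEquiv A B) : MoveDetEquiv B A :=
  ⟨h.1.symm, h.2.symm⟩

theorem trans {A : Matrix X X ℕ} {B : Matrix Y Y ℕ} {C : Matrix Z Z ℕ}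
    (h : MoveDetEquiv A B) (h' : MoveDetEquiv B C) : MoveDetEquiv A C :=
  ⟨h.1.trans h'.1, h.2.trans h'.2⟩

theorem submatrix (φ : Y ≃ X) (A : Matrix X X ℕ) : MoveDetEquiv A (A.submatrix φ φ) := by
  refine ⟨moveEquiv_submatrix φ A, ?_⟩
  rw [← Matrix.det_submatrix_equiv_self φ, Matrix.submatrix_sub, Pi.sub_apply, Pi.sub_apply,
    Matrix.submatrix_one_equiv, Matrix.submatrix_map]

theorem det_one_sub_duplicateCol (v : X) (T : X ⊕ Unit → X → ℕ) :
    (1 - (amalgamateRow v T).map ((↑) : ℕ → ℤ)).det =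
      (1 - (duplicateCol v T).map ((↑) : ℕ → ℤ)).det := by
  let S : Matrix X (X ⊕ Unit) ℤ := Matrix.of fun x =>
    Sum.elim (fun y => if y = x then 1 else 0) fun _ => if v = x then 1 else 0
  let T' : Matrix (X ⊕ Unit) X ℤ := Matrix.of fun z x => (T z x : ℤ)
  have h₁ : (amalgamateRow v T).map ((↑) : ℕ → ℤ) = S * T' := by
    ext x y
    by_cases h : x = v <;>
      simp [amalgamateRow, S, T', Matrix.mul_apply, h, @eq_comm _ v x]
  have h₂ : (duplicateCol v T).map ((↑) : ℕ → ℤ) = T' * S := by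
    ext z (x | x) <;> simp [duplicateCol, S, T', Matrix.mul_apply, fold]
  rw [h₁, h₂, Matrix.det_one_sub_mul_comm]

theorem duplicateCol (v : X) (T : X ⊕ Unit → X → ℕ)
    (h₀ : ∃ y, T (Sum.inl v) y ≠ 0) (h₁ : ∃ y, T (Sum.inr ()) y ≠ 0) :
    MoveDetEquiv (amalgamateRow v T) (duplicateCol v T) :=
  ⟨moveEquiv_duplicateCol v T h₀ h₁, det_one_sub_duplicateCol v T⟩

theorem duplicateCol_transpose (v : X) (T : X ⊕ Unit → X → ℕ)
    (h₀ : ∃ y, T (Sum.inl v) y ≠ 0) (h₁ : ∃ y, T (Sum.inr ()) y ≠ 0)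
    (hv : ∃ x, T x v ≠ 0) :
    MoveDetEquiv (amalgamateRow v T).transpose (CKGraph.duplicateCol v T).transpose := by
  refine ⟨moveEquiv_duplicateCol_transpose v T h₀ h₁ hv, ?_⟩
  have := det_one_sub_duplicateCol v T
  rwa [← Matrix.det_transpose, ← Matrix.det_transpose (1 - Matrix.map _ _),
    Matrix.transpose_sub, Matrix.transpose_sub, Matrix.transpose_one, Matrix.transpose_one,
    ← Matrix.transpose_map, ← Matrix.transpose_map] at this

theorem addVertex_of_support (A : Matrix X X ℕ) (c : X → ℕ) (a w : X)
    (hc : ∀ x, c x ≠ 0 → x = a) :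
    MoveDetEquiv (addVertex A c (Pi.single w 1)) (A + Matrix.vecMulVec c (Pi.single w 1)) := by
  refine ⟨moveEquiv_addVertex_of_support A c a w hc, ?_⟩
  have : (1 : Matrix (X ⊕ Unit) (X ⊕ Unit) ℤ) -
      (addVertex A c (Pi.single w 1)).map ((↑) : ℕ → ℤ) =
      Matrix.fromBlocks (1 - A.map ((↑) : ℕ → ℤ))
        (-Matrix.replicateCol Unit fun x => (c x : ℤ))
        (-Matrix.replicateRow Unit fun x => ((Pi.single w 1 : X → ℕ) x : ℤ)) 1 := by
    ext (x | x) (y | y) <;> simp [addVertex, Matrix.one_apply]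
  rw [this, Matrix.det_fromBlocks_one₂₂]
  congr 1
  ext x y
  simp [Matrix.mul_apply, Matrix.vecMulVec_apply, sub_sub]

/-- Every function to `ℕ` on a finite type is a sum of indicator functions of points. -/
theorem nat_fun_induction {p : (X → ℕ) → Prop} (zero : p 0)
    (single_add : ∀ f a, p f → p (Pi.single a 1 + f)) (f : X → ℕ) : p f := by
  induction h : ∑ x, f x generalizing f with
  | zero =>
    have : f = 0 := by
      ext x
      simpa using (Finset.sum_eq_zero_iff.1 h) x (Finset.mem_univ x)
    rwa [this]
  | succ n ih =>
    obtain ⟨a, -, ha⟩ : ∃ a ∈ Finset.univ, f a ≠ 0 :=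
      Finset.exists_ne_zero_of_sum_ne_zero (by omega)
    have hf : Pi.single a 1 + (f - Pi.single a 1) = f := by
      ext x
      by_cases hx : x = a
      · subst hx; simp; omega
      · simp [hx]
    rw [← hf]
    refine single_add _ a (ih _ ?_)
    have := congrArg (fun g : X → ℕ => ∑ x, g x) hf
    simp only [Pi.add_apply, Finset.sum_add_distrib] at this
    simp at this h ⊢
    omega

theorem addVertex_single (A : Matrix X X ℕ) (c : X → ℕ) (w : X) :
    MoveDetEquiv (addVertex A c (Pi.single w 1)) (A + Matrix.vecMulVec c (Pi.single w 1)) := by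
  induction c using nat_fun_induction generalizing A with
  | zero => exact addVertex_of_support A 0 w w (by simp)
  | single_add c a ih =>
    by_cases hc : c = 0
    · subst hc
      refine addVertex_of_support A _ a w fun x hx => ?_
      by_contra h
      simp [h] at hx
    obtain ⟨b, hb⟩ := Function.ne_iff.1 hc
    let A' := addVertex A c (Pi.single w 1)
    let T : (X ⊕ Unit) ⊕ Unit → X ⊕ Unit → ℕ :=
      Sum.elim (fun x y => A' y x) fun _ => Sum.elim (Pi.single a 1) 0
    have h₁ : addVertex A (Pi.single a 1 + c) (Pi.single w 1) =
        (amalgamateRow (Sum.inr ()) T).transpose := by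
      ext (x | x) (y | y) <;> simp [amalgamateRow, T, A', addVertex, add_comm, Pi.single_apply]
    have h₂ : (CKGraph.duplicateCol (Sum.inr ()) T).transpose =
        addVertex A' (Sum.elim (Pi.single a 1) 0) (Pi.single (Sum.inl w) 1) := by
      ext ((x | x) | x) ((y | y) | y) <;>
        simp [CKGraph.duplicateCol, T, A', addVertex, fold, Pi.single_apply]
    have h₃ : A' + Matrix.vecMulVec (Sum.elim (Pi.single a 1) 0) (Pi.single (Sum.inl w) 1) =
        addVertex (A + Matrix.vecMulVec (Pi.single a 1) (Pi.single w 1)) c (Pi.single w 1) := by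
      ext (x | x) (y | y) <;>
        simp [A', addVertex, Matrix.vecMulVec_apply, Pi.single_apply]
    have h₄ : A + Matrix.vecMulVec (Pi.single a 1) (Pi.single w 1) +
        Matrix.vecMulVec c (Pi.single w 1) =
        A + Matrix.vecMulVec (Pi.single a 1 + c) (Pi.single w 1) := by
      rw [Matrix.add_vecMulVec, add_assoc]
    rw [h₁, ← h₄]
    refine (duplicateCol_transpose (Sum.inr ()) T ⟨Sum.inl b, by simpa [T, A', addVertex] using hb⟩
      ⟨Sum.inl a, by simp [T]⟩ ⟨Sum.inl (Sum.inl w), by simp [T, A', addVertex]⟩).trans ?_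
    rw [h₂]
    refine (addVertex_of_support A' _ (Sum.inl a) (Sum.inl w) ?_).trans (h₃ ▸ ih _)
    rintro (x | x) hx
    · by_contra h
      simp [show x ≠ a from fun h' => h (congrArg _ h')] at hx
    · simp at hx

theorem addVertex (A : Matrix X X ℕ) (c r : X → ℕ) (hr : r ≠ 0) :
    MoveDetEquiv (addVertex A c r) (A + Matrix.vecMulVec c r) := by
  induction r using nat_fun_induction generalizing A with
  | zero => exact (hr rfl).elim
  | single_add r w ih =>
    by_cases hr₀ : r = 0
    · subst hr₀
      simpa using addVertex_single A c w
    obtain ⟨b, hb⟩ := Function.ne_iff.1 hr₀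
    let A' := CKGraph.addVertex A c r
    let T : (X ⊕ Unit) ⊕ Unit → X ⊕ Unit → ℕ :=
      Sum.elim (fun x y => A' x y) fun _ => Sum.elim (Pi.single w 1) 0
    have h₁ : CKGraph.addVertex A c (Pi.single w 1 + r) = amalgamateRow (Sum.inr ()) T := by
      ext (x | x) (y | y) <;>
        simp [amalgamateRow, T, A', CKGraph.addVertex, add_comm, Pi.single_apply]
    have h₂ : CKGraph.duplicateCol (Sum.inr ()) T =
        CKGraph.addVertex A' (Sum.elim c 0) (Pi.single (Sum.inl w) 1) := by
      ext ((x | x) | x) ((y | y) | y) <;>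
        simp [CKGraph.duplicateCol, T, A', CKGraph.addVertex, fold, Pi.single_apply]
    have h₃ : A' + Matrix.vecMulVec (Sum.elim c 0) (Pi.single (Sum.inl w) 1) =
        CKGraph.addVertex (A + Matrix.vecMulVec c (Pi.single w 1)) c r := by
      ext (x | x) (y | y) <;>
        simp [A', CKGraph.addVertex, Matrix.vecMulVec_apply, Pi.single_apply]
    rw [h₁, Matrix.vecMulVec_add, ← add_assoc]
    refine (duplicateCol (Sum.inr ()) T ⟨Sum.inl b, by simpa [T, A', CKGraph.addVertex] using hb⟩
      ⟨Sum.inl w, by simp [T]⟩).trans ?_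
    rw [h₂]
    exact (addVertex_single A' _ (Sum.inl w)).trans (h₃ ▸ ih _ hr₀)

/-- Adding the column `u` of `B` to the column `v`. -/
theorem add_col (B : Matrix X X ℕ) {u v : X} (huv : u ≠ v) (h : B u v ≠ 0) :
    MoveDetEquiv (1 + B) (1 + B.updateCol v fun x => B x v + B x u) := by
  let T : X ⊕ Unit → X → ℕ :=
    Sum.elim (fun x y => (1 + B) x y - if x = u ∧ y = v then 1 else 0) fun _ => Pi.single v 1
  have h₁ : 1 + B = amalgamateRow u T := by
    ext x y
    by_cases hx : x = u <;> by_cases hy : y = v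
    · subst hx hy
      simp [amalgamateRow, T]
      omega
    all_goals simp [amalgamateRow, T, hx, hy]
  have h₂ : CKGraph.duplicateCol u T = CKGraph.addVertex (Matrix.of fun x y => T (Sum.inl x) y)
      (fun x => T (Sum.inl x) u) (Pi.single v 1) := by
    ext (x | x) (y | y) <;> simp [CKGraph.duplicateCol, T, CKGraph.addVertex, fold, huv]
  have h₃ : Matrix.of (fun x y => T (Sum.inl x) y) +
      Matrix.vecMulVec (fun x => T (Sum.inl x) u) (Pi.single v 1) =
      1 + B.updateCol v fun x => B x v + B x u := by
    ext x y
    by_cases hx : x = u <;> by_cases hy : y = v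
    · subst hx hy
      simp [T, Matrix.vecMulVec_apply, huv]
      omega
    · subst hx
      simp [T, Matrix.vecMulVec_apply, hy]
    · subst hy
      simp [T, Matrix.vecMulVec_apply, hx, huv, add_assoc]
    · simp [T, Matrix.vecMulVec_apply, hx, hy]
  rw [h₁, ← h₃]
  refine (duplicateCol u T ⟨u, by simp [T, huv]⟩ ⟨v, by simp [T]⟩).trans ?_
  rw [h₂]
  exact addVertex_single _ _ _

/-- Splitting off one loop at `v` from a matrix `1 + B`. -/
theorem split_loop (B : Matrix X X ℕ) (v : X) (h : B v v ≠ 0) :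
    MoveDetEquiv (1 + B) (1 + Matrix.fromBlocks
      (B - Matrix.single v v 1) (Matrix.replicateCol Unit fun x => B x v)
      (Matrix.replicateRow Unit (Pi.single v 1)) 0) := by
  let T : X ⊕ Unit → X → ℕ :=
    Sum.elim (fun x y => if x = v then B x y else (1 + B) x y) fun _ => Pi.single v 1
  have h₁ : 1 + B = amalgamateRow v T := by
    ext x y
    by_cases hx : x = v
    · subst hx
      simp [amalgamateRow, T, Matrix.one_apply, Pi.single_apply, add_comm, @eq_comm _ x y]
    · simp [amalgamateRow, T, hx]
  have h₂ : CKGraph.duplicateCol v T = 1 + Matrix.fromBlocks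
      (B - Matrix.single v v 1) (Matrix.replicateCol Unit fun x => B x v)
      (Matrix.replicateRow Unit (Pi.single v 1)) 0 := by
    ext (x | x) (y | y)
    · by_cases hx : x = v
      · subst hx
        by_cases hy : y = x
        · subst hy
          simp [CKGraph.duplicateCol, T, fold]
          omega
        · simp [CKGraph.duplicateCol, T, fold, Matrix.one_apply, Ne.symm hy]
      · simp [CKGraph.duplicateCol, T, fold, hx, Ne.symm hx, Matrix.one_apply]
    · by_cases hx : x = v <;> simp [CKGraph.duplicateCol, T, fold, hx]
    · simp [CKGraph.duplicateCol, T, fold]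
    · simp [CKGraph.duplicateCol, T, fold]
  rw [h₁, ← h₂]
  exact duplicateCol v T ⟨v, by simpa [T] using h⟩ ⟨v, by simp [T]⟩

end MoveDetEquiv

/-- Any two vertices are joined by a nonempty path of nonzero entries of `A`. -/
def StronglyConnected {X : Type} (A : Matrix X X ℕ) : Prop :=
  ∀ x y, Relation.TransGen (fun i j => A i j ≠ 0) x y

theorem MatIrreducible.stronglyConnected {n : ℕ} {A : Matrix (Fin n) (Fin n) ℕ}
    (h : MatIrreducible A) : StronglyConnected A := by
  intro x y
  obtain ⟨l, c, hl, rfl, rfl, hc⟩ := h x y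
  have key : ∀ t, t + 1 ≤ l → Relation.TransGen (fun i j => A i j ≠ 0) (c 0) (c (t + 1)) := by
    intro t
    induction t with
    | zero => exact fun h => .single (hc 0 h)
    | succ t ih => exact fun h => (ih (by omega)).tail (hc (t + 1) h)
  obtain ⟨t, rfl⟩ : ∃ t, l = t + 1 := ⟨l - 1, by omega⟩
  exact key t le_rfl

namespace StronglyConnected

variable {X : Type}

theorem mono {A B : Matrix X X ℕ} (hA : StronglyConnected A) (h : ∀ x y, A x y ≠ 0 → B x y ≠ 0) :
    StronglyConnected B := fun x y => Relation.TransGen.mono h x y (hA x y)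

theorem exists_ne_zero_right {A : Matrix X X ℕ} (hA : StronglyConnected A) (x : X) :
    ∃ y, A x y ≠ 0 := by
  obtain ⟨y, h, -⟩ := Relation.TransGen.head'_iff.1 (hA x x)
  exact ⟨y, h⟩

theorem exists_ne_zero_left {A : Matrix X X ℕ} (hA : StronglyConnected A) (y : X) :
    ∃ x, A x y ≠ 0 := by
  obtain ⟨x, -, h⟩ := Relation.TransGen.tail'_iff.1 (hA y y)
  exact ⟨x, h⟩

variable [Fintype X] [DecidableEq X]

/-- A strongly connected matrix that is not a permutation matrix has a row with sum at
least two. -/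
theorem exists_two_le_row_sum {A : Matrix X X ℕ} (hA : StronglyConnected A)
    (hperm : ¬ ∃ σ : Equiv.Perm X, ∀ i j, A i j = if σ i = j then 1 else 0) :
    ∃ x, 2 ≤ ∑ y, A x y := by
  by_contra! hrow
  choose f hf using hA.exists_ne_zero_right
  have hA₁ : ∀ i j, A i j = if f i = j then 1 else 0 := by
    intro i j
    have h := hrow i
    rw [← Finset.add_sum_erase _ _ (Finset.mem_univ (f i))] at h
    have h₁ := hf i
    split_ifs with hij
    · subst hij; omega
    · have : A i j ≤ ∑ y ∈ Finset.univ.erase (f i), A i y :=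
        Finset.single_le_sum (f := fun y => A i y) (fun _ _ => Nat.zero_le _)
          (Finset.mem_erase.2 ⟨Ne.symm hij, Finset.mem_univ j⟩)
      omega
  have hsurj : Function.Surjective f := fun y => by
    obtain ⟨x, hx⟩ := hA.exists_ne_zero_left y
    refine ⟨x, ?_⟩
    by_contra h
    simp [hA₁, h] at hx
  exact hperm ⟨Equiv.ofBijective f hsurj.bijective_of_finite, hA₁⟩

/-- Deleting the identity from a strongly connected matrix with nonzero diagonal. -/
theorem of_one_add {B : Matrix X X ℕ} (h : StronglyConnected (1 + B))
    (hrow : ∃ x, 2 ≤ ∑ y, (1 + B) x y) : StronglyConnected B := by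
  have hne : ∀ x y, x ≠ y → Relation.TransGen (fun i j => B i j ≠ 0) x y := by
    intro x y hxy
    have : Relation.ReflTransGen (fun i j => B i j ≠ 0) x y := by
      induction h x y with
      | @single y h =>
        by_cases hxy : x = y
        · exact hxy ▸ .refl
        · exact .single (by simpa [Matrix.one_apply, hxy] using h)
      | @tail y z _ h ih =>
        have ih : Relation.ReflTransGen (fun i j => B i j ≠ 0) x y := by
          by_cases hxy : x = y
          · exact hxy ▸ .refl
          · exact ih hxy
        by_cases hyz : y = z
        · exact hyz ▸ ih
        · exact ih.tail (by simpa [Matrix.one_apply, hyz] using h)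
    exact (Relation.reflTransGen_iff_eq_or_transGen.1 this).resolve_left (Ne.symm hxy)
  intro x y
  by_cases hxy : x = y
  · subst hxy
    by_cases hx : ∃ z, x ≠ z
    · obtain ⟨z, hz⟩ := hx
      exact (hne x z hz).trans (hne z x hz.symm)
    · push Not at hx
      obtain ⟨w, hw⟩ := hrow
      obtain rfl := hx w
      rw [Fintype.sum_eq_single x fun y hy => (hy (hx y).symm).elim] at hw
      refine .single ?_
      simp at hw
      omega
  · exact hne x y hxy

end StronglyConnected

/-- Deleting a loopless vertex of `Fin (k + 1)` and joining its incoming to its outgoing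
edges. -/
def collapseVertex {k : ℕ} (A : Matrix (Fin (k + 1)) (Fin (k + 1)) ℕ) (u : Fin (k + 1)) :
    Matrix (Fin k) (Fin k) ℕ :=
  A.submatrix u.succAbove u.succAbove +
    Matrix.vecMulVec (fun i => A (u.succAbove i) u) (fun j => A u (u.succAbove j))

theorem StronglyConnected.collapseVertex {k : ℕ} {A : Matrix (Fin (k + 1)) (Fin (k + 1)) ℕ}
    (hA : StronglyConnected A) {u : Fin (k + 1)} (hu : A u u = 0) :
    StronglyConnected (collapseVertex A u) := by
  set C := _root_.collapseVertex A u with hC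
  have key : ∀ i y, Relation.TransGen (fun i j => A i j ≠ 0) (u.succAbove i) y →
      (∀ j, y = u.succAbove j → Relation.TransGen (fun i j => C i j ≠ 0) i j) ∧
      (y = u → ∃ i', Relation.ReflTransGen (fun i j => C i j ≠ 0) i i' ∧
        A (u.succAbove i') u ≠ 0) := by
    intro i y h
    induction h with
    | single h =>
      refine ⟨?_, ?_⟩
      · rintro j rfl
        exact .single (by simp [hC, _root_.collapseVertex, h])
      · rintro rfl
        exact ⟨i, .refl, h⟩
    | @tail y z _ h ih =>
      rcases Fin.eq_self_or_eq_succAbove u y with rfl | ⟨l, rfl⟩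
      · obtain ⟨i', hi', hu'⟩ := ih.2 rfl
        refine ⟨?_, ?_⟩
        · rintro j rfl
          exact .tail' hi' (by simp [hC, _root_.collapseVertex, Matrix.vecMulVec_apply, h, hu'])
        · rintro rfl
          exact (h hu).elim
      · have hl := ih.1 l rfl
        refine ⟨?_, ?_⟩
        · rintro j rfl
          exact hl.tail (by simp [hC, _root_.collapseVertex, h])
        · rintro rfl
          exact ⟨l, hl.to_reflTransGen, h⟩
  exact fun i j => (key i _ (hA _ _)).1 j rfl

theorem exists_two_le_row_sum_collapseVertex {k : ℕ}
    {A : Matrix (Fin (k + 1)) (Fin (k + 1)) ℕ} (hA : StronglyConnected A) {u : Fin (k + 1)}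
    (hu : A u u = 0) (hrow : ∃ x, 2 ≤ ∑ y, A x y) :
    ∃ x, 2 ≤ ∑ y, collapseVertex A u x y := by
  have hsum : ∀ i, ∑ j, collapseVertex A u i j = ∑ j, A (u.succAbove i) (u.succAbove j) +
      A (u.succAbove i) u * ∑ j, A u (u.succAbove j) := fun i => by
    simp [collapseVertex, Matrix.vecMulVec_apply, Finset.sum_add_distrib, Finset.mul_sum]
  have hpos : 1 ≤ ∑ j, A u (u.succAbove j) := by
    obtain ⟨y, hy⟩ := hA.exists_ne_zero_right u
    rcases Fin.eq_self_or_eq_succAbove u y with rfl | ⟨j, rfl⟩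
    · exact (hy hu).elim
    · exact (Nat.one_le_iff_ne_zero.2 hy).trans (Finset.single_le_sum
        (f := fun j => A u (u.succAbove j)) (fun _ _ => Nat.zero_le _) (Finset.mem_univ j))
  obtain ⟨x, hx⟩ := hrow
  rw [Fin.sum_univ_succAbove _ u] at hx
  rcases Fin.eq_self_or_eq_succAbove u x with rfl | ⟨i, rfl⟩
  · obtain ⟨y, hy⟩ := hA.exists_ne_zero_left x
    rcases Fin.eq_self_or_eq_succAbove x y with rfl | ⟨i, rfl⟩
    · exact (hy hu).elim
    · refine ⟨i, ?_⟩
      rw [hsum]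
      have := Nat.mul_le_mul (Nat.one_le_iff_ne_zero.2 hy) hx
      simp only [hu, zero_add] at this
      omega
  · refine ⟨i, ?_⟩
    rw [hsum]
    have := Nat.mul_le_mul_left (A (u.succAbove i) u) hpos
    omega

theorem MoveDetEquiv.collapseVertex {k : ℕ} {A : Matrix (Fin (k + 1)) (Fin (k + 1)) ℕ}
    {u : Fin (k + 1)} (hu : A u u = 0) (hr : ∃ y, A u y ≠ 0) :
    MoveDetEquiv A (collapseVertex A u) := by
  let φ : Fin k ⊕ Unit ≃ Fin (k + 1) :=
    (Equiv.optionEquivSumPUnit (Fin k)).symm.trans (finSuccEquiv' u).symm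
  have h : A.submatrix φ φ = CKGraph.addVertex (A.submatrix u.succAbove u.succAbove)
      (fun i => A (u.succAbove i) u) (fun j => A u (u.succAbove j)) := by
    ext (x | x) (y | y) <;> simp [φ, CKGraph.addVertex, hu]
  refine (MoveDetEquiv.submatrix φ A).trans (h ▸ MoveDetEquiv.addVertex _ _ _ fun h0 => ?_)
  obtain ⟨y, hy⟩ := hr
  rcases Fin.eq_self_or_eq_succAbove u y with rfl | ⟨j, rfl⟩
  · exact hy hu
  · exact hy (congrFun h0 j)

/-- Collapsing all loopless vertices. -/
theorem exists_moveDetEquiv_one_add {k : ℕ} (A : Matrix (Fin k) (Fin k) ℕ)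
    (hA : StronglyConnected A) (hrow : ∃ x, 2 ≤ ∑ y, A x y) :
    ∃ (m : ℕ) (B : Matrix (Fin m) (Fin m) ℕ), 0 < m ∧ MoveDetEquiv A (1 + B) ∧
      StronglyConnected B := by
  induction k with
  | zero => obtain ⟨x, -⟩ := hrow; exact x.elim0
  | succ k ih =>
    by_cases h : ∃ u, A u u = 0
    · obtain ⟨u, hu⟩ := h
      obtain ⟨m, B, hm, hB, hB'⟩ := ih _ (hA.collapseVertex hu)
        (exists_two_le_row_sum_collapseVertex hA hu hrow)
      exact ⟨m, B, hm,
        (MoveDetEquiv.collapseVertex hu (hA.exists_ne_zero_right u)).trans hB, hB'⟩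
    · push Not at h
      have hB : 1 + (A - 1) = A := by
        ext x y
        by_cases hxy : x = y
        · subst hxy
          have := h x
          simp
          omega
        · simp [hxy]
      refine ⟨k + 1, A - 1, k.succ_pos, hB.symm ▸ MoveDetEquiv.refl A, ?_⟩
      exact StronglyConnected.of_one_add (hB.symm ▸ hA) (hB.symm ▸ hrow)

theorem exists_pos_of_stronglyConnected {X : Type} [Fintype X] [DecidableEq X]
    (B : Matrix X X ℕ) (hB : StronglyConnected B) :
    ∃ B' : Matrix X X ℕ, (∀ x y, 0 < B' x y) ∧ MoveDetEquiv (1 + B) (1 + B') := by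
  induction h : (Finset.univ.filter fun p : X × X => B p.1 p.2 = 0).card
    using Nat.strong_induction_on generalizing B with
  | _ n ih =>
    by_cases htrans : ∀ x u v, B x u ≠ 0 → B u v ≠ 0 → B x v ≠ 0
    · refine ⟨B, fun x y => Nat.pos_of_ne_zero ?_, MoveDetEquiv.refl _⟩
      induction hB x y with
      | single h => exact h
      | tail _ h ih => exact htrans _ _ _ ih h
    · push Not at htrans
      obtain ⟨x, u, v, hxu, huv, hxv⟩ := htrans
      have hne : u ≠ v := by rintro rfl; exact hxu hxv
      have hmono : ∀ i j, B i j ≠ 0 → B.updateCol v (fun x => B x v + B x u) i j ≠ 0 := by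
        intro i j hij
        by_cases hj : j = v
        · subst hj; simp [hij]
        · simpa [hj] using hij
      have hlt : (Finset.univ.filter fun p : X × X =>
          B.updateCol v (fun x => B x v + B x u) p.1 p.2 = 0).card < n := by
        rw [← h]
        refine Finset.card_lt_card ((Finset.ssubset_iff_of_subset fun p => ?_).2
          ⟨(x, v), by simpa using hxv, by simp [hxu]⟩)
        simp only [Finset.mem_filter, Finset.mem_univ, true_and]
        exact fun hp => by_contra fun h => hmono _ _ h hp
      obtain ⟨B', hpos, hB'⟩ := ih _ hlt _ (hB.mono hmono) rfl
      exact ⟨B', hpos, (MoveDetEquiv.add_col B hne huv).trans hB'⟩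

theorem exists_pos_sum_unit {X : Type} [Fintype X] [DecidableEq X] [Nonempty X]
    (B : Matrix X X ℕ) (hB : ∀ x y, 0 < B x y) :
    ∃ B' : Matrix (X ⊕ Unit) (X ⊕ Unit) ℕ, (∀ x y, 0 < B' x y) ∧
      MoveDetEquiv (1 + B) (1 + B') := by
  obtain ⟨v⟩ := ‹Nonempty X›
  set C : Matrix (X ⊕ Unit) (X ⊕ Unit) ℕ := Matrix.fromBlocks
      (B - Matrix.single v v 1) (Matrix.replicateCol Unit fun x => B x v)
      (Matrix.replicateRow Unit (Pi.single v 1)) 0 with hC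
  have hto : ∀ x, C (Sum.inl x) (Sum.inr ()) ≠ 0 := fun x => by simp [hC, (hB x v).ne']
  have hfrom : C (Sum.inr ()) (Sum.inl v) ≠ 0 := by simp [hC]
  have h₁ : ∀ z, Relation.TransGen (fun i j => C i j ≠ 0) z (Sum.inl v) := by
    rintro (x | x)
    · exact .head (hto x) (.single hfrom)
    · exact .single hfrom
  have h₂ : ∀ z, Relation.ReflTransGen (fun i j => C i j ≠ 0) (Sum.inl v) z := by
    rintro (x | x)
    · by_cases hx : x = v
      · subst hx; exact .refl
      · exact .single (by simp [hC, Ne.symm hx, (hB v x).ne'])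
    · exact .single (hto v)
  obtain ⟨B', hpos, h⟩ := exists_pos_of_stronglyConnected C fun x y => (h₁ x).trans_left (h₂ y)
  exact ⟨B', hpos, (MoveDetEquiv.split_loop B v (hB v v).ne').trans h⟩

theorem exists_pos_of_le {m : ℕ} (hm : 0 < m) (B : Matrix (Fin m) (Fin m) ℕ)
    (hB : ∀ x y, 0 < B x y) {n : ℕ} (hn : m ≤ n) :
    ∃ B' : Matrix (Fin n) (Fin n) ℕ, (∀ x y, 0 < B' x y) ∧ MoveDetEquiv (1 + B) (1 + B') := by
  induction n, hn using Nat.le_induction with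
  | base => exact ⟨B, hB, MoveDetEquiv.refl _⟩
  | succ n hn ih =>
    obtain ⟨B₁, hpos₁, h₁⟩ := ih
    have : Nonempty (Fin n) := ⟨⟨0, hm.trans_le hn⟩⟩
    obtain ⟨B₂, hpos₂, h₂⟩ := exists_pos_sum_unit B₁ hpos₁
    let φ : Fin (n + 1) ≃ Fin n ⊕ Unit := Fintype.equivOfCardEq (by simp)
    refine ⟨B₂.submatrix φ φ, fun x y => hpos₂ _ _, (h₁.trans h₂).trans ?_⟩
    have h₃ := MoveDetEquiv.submatrix φ (1 + B₂)
    rwa [Matrix.submatrix_add, Pi.add_apply, Pi.add_apply, Matrix.submatrix_one_equiv] at h₃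

/-- every irreducible non-permutation non-negative integer matrix is
move-equivalent to `I + B` with `B` strictly positive of any sufficiently large size,
preserving the determinant in the form `det(I - A) = det(-B)`. -/
theorem stmt16 {n₀ : ℕ} (A : Matrix (Fin n₀) (Fin n₀) ℕ)
    (hirr : MatIrreducible A)
    (hperm : ¬ ∃ σ : Equiv.Perm (Fin n₀), ∀ i j, A i j = if σ i = j then 1 else 0) :
    ∃ N : ℕ, ∀ n : ℕ, N < n → ∃ B : Matrix (Fin n) (Fin n) ℕ,
      (∀ i j, 0 < B i j) ∧
      MatMoveEquiv (A.map ((↑) : ℕ → ℕ∞)) ((1 + B).map ((↑) : ℕ → ℕ∞)) ∧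
      Matrix.det ((1 : Matrix (Fin n₀) (Fin n₀) ℤ) - A.map ((↑) : ℕ → ℤ)) =
        Matrix.det (-(B.map ((↑) : ℕ → ℤ))) := by
  have hA := hirr.stronglyConnected
  obtain ⟨m, B, hm, hAB, hB⟩ := exists_moveDetEquiv_one_add A hA (hA.exists_two_le_row_sum hperm)
  obtain ⟨B₁, hpos₁, h₁⟩ := exists_pos_of_stronglyConnected B hB
  refine ⟨m, fun n hn => ?_⟩
  obtain ⟨B₂, hpos₂, h₂⟩ := exists_pos_of_le hm B₁ hpos₁ hn.le
  have h := (hAB.trans h₁).trans h₂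
  refine ⟨B₂, hpos₂, (moveEquiv_graphOfMatrix A).symm.trans
    (h.moveEquiv.trans (moveEquiv_graphOfMatrix (1 + B₂))), h.det_eq.trans ?_⟩
  congr 1
  ext x y
  simp [Matrix.one_apply]
end

section
/- Let G be a graph with n < ∞ vertices and no infinite emitters, with adjacency matrix A_G ∈ Mₙ(ℤ), and let E arise from G by a Cuntz splice at a regular vertex v of G that supports at least two simple loops, with adjacency matrix A_E ∈ M_{n+2}(ℤ). Then there exist invertible integer matrices P, Q ∈ GL_{n+2}(ℤ) such that P·(I − A_E)·Q is the block diagonal matrix diag(1, 1) ⊕ (I − A_G); consequently the cokernels of I − A_E and I − A_G (as ℤ-linear maps) are isomorphic abelian groups, and likewise their kernels are isomorphic. -/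
section

open Matrix

theorem nonempty_coker_ker_equiv_of_prod {R A X Y M N : Type*} [CommRing R]
    [AddCommGroup A] [Module R A] [AddCommGroup X] [Module R X] [AddCommGroup Y] [Module R Y]
    [AddCommGroup M] [Module R M] [AddCommGroup N] [Module R N]
    (f : X →ₗ[R] Y) (g : M →ₗ[R] N) (e₁ : X ≃ₗ[R] A × M) (e₂ : Y ≃ₗ[R] A × N)
    (h : ∀ x, e₂ (f x) = ((e₁ x).1, g (e₁ x).2)) :
    Nonempty ((Y ⧸ LinearMap.range f) ≃ₗ[R] (N ⧸ LinearMap.range g)) ∧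
      Nonempty (LinearMap.ker f ≃ₗ[R] LinearMap.ker g) := by
  constructor
  · let q : Y →ₗ[R] N ⧸ LinearMap.range g :=
      (LinearMap.range g).mkQ ∘ₗ LinearMap.snd R A N ∘ₗ e₂.toLinearMap
    have hq : Function.Surjective q :=
      (Submodule.mkQ_surjective _).comp (Prod.snd_surjective.comp e₂.surjective)
    have hker : LinearMap.range f = LinearMap.ker q := by
      ext y
      simp only [LinearMap.mem_range, LinearMap.mem_ker, q, LinearMap.comp_apply,
        Submodule.mkQ_apply, Submodule.Quotient.mk_eq_zero, LinearMap.snd_apply,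
        LinearEquiv.coe_coe]
      constructor
      · rintro ⟨x, rfl⟩
        exact ⟨(e₁ x).2, by rw [h]⟩
      · rintro ⟨m, hm⟩
        refine ⟨e₁.symm ((e₂ y).1, m), e₂.injective ?_⟩
        rw [h, LinearEquiv.apply_symm_apply]
        exact Prod.ext rfl hm
    exact ⟨(Submodule.quotEquivOfEq _ _ hker).trans (q.quotKerEquivOfSurjective hq)⟩
  · have hmem (x : X) : f x = 0 ↔ (e₁ x).1 = 0 ∧ g (e₁ x).2 = 0 := by
      rw [← e₂.map_eq_zero_iff, h, Prod.mk_eq_zero]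
    let k : LinearMap.ker f →ₗ[R] LinearMap.ker g :=
      (LinearMap.snd R A M ∘ₗ e₁.toLinearMap).restrict fun x hx => ((hmem x).1 hx).2
    refine ⟨LinearEquiv.ofBijective k ⟨?_, ?_⟩⟩
    · rintro ⟨x, hx⟩ ⟨y, hy⟩ hxy
      have h2 : (e₁ x).2 = (e₁ y).2 := congrArg Subtype.val hxy
      exact Subtype.ext (e₁.injective
        (Prod.ext ((((hmem x).1 hx).1).trans ((hmem y).1 hy).1.symm) h2))
    · rintro ⟨m, hm⟩
      have hx : f (e₁.symm (0, m)) = 0 := by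
        rw [hmem, LinearEquiv.apply_symm_apply]
        exact ⟨rfl, hm⟩
      refine ⟨⟨_, hx⟩, Subtype.ext ?_⟩
      change (e₁ (e₁.symm (0, m))).2 = m
      rw [LinearEquiv.apply_symm_apply]

theorem Matrix.nonempty_coker_ker_equiv_of_mul_mul_eq_one_block {R m p n : Type*} [CommRing R]
    [Fintype m] [DecidableEq m] [Fintype p] [DecidableEq p] [Fintype n] [DecidableEq n]
    (P A Q : Matrix m m R) (B : Matrix n n R) (e : p ⊕ n ≃ m)
    (hP : IsUnit P.det) (hQ : IsUnit Q.det)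
    (h : P * A * Q = reindex e e (fromBlocks 1 0 0 B)) :
    Nonempty (((m → R) ⧸ LinearMap.range A.mulVecLin) ≃ₗ[R]
        ((n → R) ⧸ LinearMap.range B.mulVecLin)) ∧
      Nonempty (LinearMap.ker A.mulVecLin ≃ₗ[R] LinearMap.ker B.mulVecLin) := by
  let split : (m → R) ≃ₗ[R] (p → R) × (n → R) :=
    (LinearEquiv.funCongrLeft R R e).trans (LinearEquiv.sumArrowLequivProdArrow p n R R)
  let eP := toLin'OfInv (nonsing_inv_mul P hP) (mul_nonsing_inv P hP)
  let eQ : (m → R) ≃ₗ[R] (m → R) := toLin'OfInv (mul_nonsing_inv Q hQ) (nonsing_inv_mul Q hQ)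
  refine nonempty_coker_ker_equiv_of_prod _ _ (eQ.trans split) (eP.trans split) fun x => ?_
  have hPA : P * A = reindex e e (fromBlocks 1 0 0 B) * Q⁻¹ := by
    rw [← h, mul_nonsing_inv_cancel_right _ _ hQ]
  have hx : P *ᵥ (A *ᵥ x) = reindex e e (fromBlocks 1 0 0 B) *ᵥ (Q⁻¹ *ᵥ x) := by
    rw [mulVec_mulVec, mulVec_mulVec, hPA]
  have heP (z : m → R) : eP z = P *ᵥ z := toLin'_apply P z
  have heQ (z : m → R) : eQ z = Q⁻¹ *ᵥ z := toLin'_apply Q⁻¹ z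
  simp only [LinearEquiv.trans_apply, heP, heQ, mulVecLin_apply]
  rw [hx]
  generalize Q⁻¹ *ᵥ x = y
  have hy : (reindex e e (fromBlocks 1 0 0 B) *ᵥ y) ∘ e =
      fromBlocks 1 0 0 B *ᵥ (y ∘ e) := by
    rw [reindex_apply, submatrix_mulVec_equiv]
    ext i
    simp
  have hs (z : m → R) : split z = (z ∘ e ∘ Sum.inl, z ∘ e ∘ Sum.inr) := rfl
  rw [hs, hs, ← Function.comp_assoc, ← Function.comp_assoc, hy, fromBlocks_mulVec]
  simp [Function.comp_assoc]

theorem Matrix.exists_mul_mul_eq_one_block {R m n p : Type*} [CommRing R]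
    [Fintype m] [DecidableEq m] [Fintype n] [DecidableEq n] [Fintype p] [DecidableEq p]
    (B : Matrix n n R) (C : Matrix n p R) (D : Matrix p n R) (F : Matrix p p R)
    (hF : F * F = 1) (hCFD : C * F * D = 0) (f : n ⊕ p ≃ m) (e : p ⊕ n ≃ m) :
    ∃ P Q : Matrix m m R, IsUnit P.det ∧ IsUnit Q.det ∧
      P * reindex f f (fromBlocks B C D F) * Q = reindex e e (fromBlocks 1 0 0 B) := by
  let P : Matrix (n ⊕ p) (n ⊕ p) R := fromBlocks 1 (-(C * F)) 0 F
  let Q : Matrix (n ⊕ p) (n ⊕ p) R := fromBlocks 1 0 (-(F * D)) 1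
  let t : m ≃ n ⊕ p := e.symm.trans (Equiv.sumComm p n)
  refine ⟨P.submatrix t f.symm, Q.submatrix f.symm t, ?_, ?_, ?_⟩
  · rw [← isUnit_iff_isUnit_det, isUnit_submatrix_equiv, isUnit_iff_isUnit_det,
      det_fromBlocks_zero₂₁, det_one, one_mul, ← isUnit_iff_isUnit_det]
    exact IsUnit.of_mul_eq_one _ hF
  · rw [← isUnit_iff_isUnit_det, isUnit_submatrix_equiv, isUnit_iff_isUnit_det,
      det_fromBlocks_zero₁₂, det_one, det_one, one_mul]
    exact isUnit_one
  · have hPQ : P * fromBlocks B C D F * Q = fromBlocks B 0 0 1 := by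
      simp [P, Q, fromBlocks_multiply, Matrix.mul_assoc, hF, hCFD]
    rw [reindex_apply, submatrix_mul_equiv, submatrix_mul_equiv, hPQ, reindex_apply]
    ext i j
    rcases hi : e.symm i with a | a <;> rcases hj : e.symm j with b | b <;>
      simp [t, hi, hj]

namespace CKGraph

theorem one_sub_adjMatrix_cuntzSplice (G : CKGraph) {n : ℕ} (ρ : G.V ≃ Fin n) (v : G.V) :
    1 - (G.cuntzSplice v).adjMatrix
        ((Equiv.sumCongr ρ (Equiv.refl (Fin 2))).trans finSumFinEquiv) =
      reindex finSumFinEquiv finSumFinEquiv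
        (fromBlocks (1 - G.adjMatrix ρ)
          (of fun i => ![if i = ρ v then -1 else 0, 0])
          (of ![fun j => if j = ρ v then -1 else 0, 0])
          !![0, -1; -1, 0]) := by
  classical
  let σ : G.V ⊕ Fin 2 ≃ Fin n ⊕ Fin 2 := Equiv.sumCongr ρ (Equiv.refl (Fin 2))
  have hadj (a b : Fin (n + 2)) : (G.cuntzSplice v).adjMatrix (σ.trans finSumFinEquiv) a b =
      (Nat.card ({e : G.E // Sum.inl (G.s e) = σ.symm (finSumFinEquiv.symm a) ∧
          Sum.inl (G.r e) = σ.symm (finSumFinEquiv.symm b)} ⊕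
        {i : Fin 6 // ![Sum.inl v, Sum.inr 0, Sum.inr 0, Sum.inr 0, Sum.inr 1, Sum.inr 1] i =
            σ.symm (finSumFinEquiv.symm a) ∧
          ![Sum.inr 0, Sum.inl v, Sum.inr 0, Sum.inr 1, Sum.inr 0, Sum.inr 1] i =
            σ.symm (finSumFinEquiv.symm b)}) : ℤ) :=
    congrArg Nat.cast (Nat.card_congr Equiv.subtypeSum)
  have hv (i : Fin n) : v = ρ.symm i ↔ i = ρ v := by
    rw [Equiv.eq_symm_apply, eq_comm]
  rw [← Equiv.symm_apply_eq]
  ext x y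
  simp only [reindex_symm, reindex_apply, submatrix_apply, Matrix.sub_apply, Equiv.symm_symm]
  rw [hadj]
  simp only [Equiv.symm_apply_apply, one_apply, EmbeddingLike.apply_eq_iff_eq]
  rcases x with i | i <;> rcases y with j | j
  · have : IsEmpty {k : Fin 6 //
        ![Sum.inl v, Sum.inr 0, Sum.inr 0, Sum.inr 0, Sum.inr 1, Sum.inr 1] k =
          σ.symm (Sum.inl i) ∧
        ![Sum.inr 0, Sum.inl v, Sum.inr 0, Sum.inr 1, Sum.inr 0, Sum.inr 1] k =
          σ.symm (Sum.inl j)} := by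
      refine ⟨fun ⟨k, hk⟩ => ?_⟩
      fin_cases k <;> simp [σ] at hk
    rw [Nat.card_congr (Equiv.sumEmpty _ _)]
    simp [σ, adjMatrix, one_apply]
  all_goals
    rw [Nat.card_congr (@Equiv.emptySum _ _ ⟨fun ⟨e, he⟩ => by simp [σ] at he⟩),
      Nat.card_eq_fintype_card, Fintype.card_subtype, Finset.card_filter, Fin.sum_univ_six]
  · fin_cases j <;> simp [σ, hv]
    split_ifs <;> rfl
  · fin_cases i <;> simp [σ, hv]
    split_ifs <;> rfl
  · fin_cases i <;> fin_cases j <;> simp [σ]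

end CKGraph

end

/-- the Cuntz splice does not change the kernel and cokernel of
`I - A`. -/
theorem stmt18 (G : CKGraph) (n : ℕ) (ρ : G.V ≃ Fin n)
    (hnoinf : ∀ v : G.V, ¬ G.IsInfiniteEmitter v)
    (v : G.V) (hreg : G.Regular v)
    (hloops : ∃ l₁ l₂ : List G.E, l₁ ≠ l₂ ∧ G.IsSimpleLoopAt v l₁ ∧
      G.IsSimpleLoopAt v l₂) :
    ∃ P Q : Matrix (Fin (n + 2)) (Fin (n + 2)) ℤ,
      IsUnit P.det ∧ IsUnit Q.det ∧
      P * (1 - CKGraph.adjMatrix (G.cuntzSplice v)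
            ((Equiv.sumCongr ρ (Equiv.refl (Fin 2))).trans finSumFinEquiv)) * Q =
        Matrix.reindex (finSumFinEquiv.trans (finCongr (by omega)))
          (finSumFinEquiv.trans (finCongr (by omega)))
          (Matrix.fromBlocks (1 : Matrix (Fin 2) (Fin 2) ℤ) 0 0
            (1 - CKGraph.adjMatrix G ρ)) ∧
      Nonempty (((Fin (n + 2) → ℤ) ⧸ LinearMap.range
          (Matrix.mulVecLin (1 - CKGraph.adjMatrix (G.cuntzSplice v)
            ((Equiv.sumCongr ρ (Equiv.refl (Fin 2))).trans finSumFinEquiv)))) ≃ₗ[ℤ]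
        ((Fin n → ℤ) ⧸ LinearMap.range
          (Matrix.mulVecLin (1 - CKGraph.adjMatrix G ρ)))) ∧
      Nonempty ((LinearMap.ker
          (Matrix.mulVecLin (1 - CKGraph.adjMatrix (G.cuntzSplice v)
            ((Equiv.sumCongr ρ (Equiv.refl (Fin 2))).trans finSumFinEquiv)))) ≃ₗ[ℤ]
        (LinearMap.ker (Matrix.mulVecLin (1 - CKGraph.adjMatrix G ρ)))) := by
  have hFF : !![0, -1; -1, 0] * !![0, -1; -1, 0] = (1 : Matrix (Fin 2) (Fin 2) ℤ) := by decide
  have hCFD : (Matrix.of fun i : Fin n => ![if i = ρ v then (-1 : ℤ) else 0, 0]) *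
      !![0, -1; -1, 0] * Matrix.of ![fun j : Fin n => if j = ρ v then -1 else 0, 0] = 0 := by
    ext i j
    simp [Matrix.mul_apply]
  obtain ⟨P, Q, hP, hQ, h⟩ := Matrix.exists_mul_mul_eq_one_block (1 - G.adjMatrix ρ) _ _ _
    hFF hCFD finSumFinEquiv (finSumFinEquiv.trans (finCongr (Nat.add_comm 2 n)))
  rw [← CKGraph.one_sub_adjMatrix_cuntzSplice] at h
  exact ⟨P, Q, hP, hQ, h,
    Matrix.nonempty_coker_ker_equiv_of_mul_mul_eq_one_block P _ Q _ _ hP hQ h⟩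
end

section
/- Let G be a graph with finitely many vertices, no loops, no infinite emitters, and exactly one sink, such that every vertex of G can reach the sink (these conditions hold whenever the graph C*-algebra C*(G) is unital, simple, and AF). Then G ∼_M E, where E is the graph with exactly one vertex and no edges. -/
namespace CKGraph

theorem HasPath.trans {G : CKGraph} {u v w : G.V} (h : G.HasPath u v) (h' : G.HasPath v w) :
    G.HasPath u w := by
  induction h with
  | single e => exact .cons e h'
  | cons e _ ih => exact .cons e (ih h')

theorem HasPath.of_removeSource {G : CKGraph} {v : G.V} {hsrc : G.IsSource v}
    {a b : (G.removeSource v hsrc).V} (h : (G.removeSource v hsrc).HasPath a b) :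
    G.HasPath a.1 b.1 := by
  induction h with
  | single e => exact .single e.1
  | cons e _ ih => exact .cons e.1 ih

theorem isSink_removeSource_iff {G : CKGraph} {v : G.V} {hsrc : G.IsSource v}
    (w : (G.removeSource v hsrc).V) : (G.removeSource v hsrc).IsSink w ↔ G.IsSink w.1 :=
  ⟨fun h e he => h ⟨e, fun hv => w.2 (he.symm.trans hv)⟩ (Subtype.ext he),
    fun h e he => h e.1 (congrArg Subtype.val he)⟩

theorem not_isInfiniteEmitter_removeSource {G : CKGraph} {v : G.V} {hsrc : G.IsSource v}
    {w : (G.removeSource v hsrc).V} (h : ¬ G.IsInfiniteEmitter w.1) :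
    ¬ (G.removeSource v hsrc).IsInfiniteEmitter w := by
  refine Set.not_infinite.mpr (Set.Finite.subset
    ((Set.not_infinite.mp h).preimage Subtype.val_injective.injOn) ?_)
  intro e he
  exact congrArg Subtype.val he

/-- In a finite graph without loops, if some vertex is not a sink then some source is
not a sink. -/
theorem exists_isSource_not_isSink {G : CKGraph} [Finite G.V]
    (hnoloop : ∀ v : G.V, ¬ G.HasPath v v) (h : ∃ v : G.V, ¬ G.IsSink v) :
    ∃ v : G.V, G.IsSource v ∧ ¬ G.IsSink v := by
  have : IsTrans G.V G.HasPath := ⟨fun _ _ _ => HasPath.trans⟩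
  have : Std.Irrefl G.HasPath := ⟨hnoloop⟩
  obtain ⟨v, hv, hmin⟩ :=
    (Finite.wellFounded_of_trans_of_irrefl G.HasPath).has_min {v | ¬ G.IsSink v} h
  refine ⟨v, fun e he => hmin (G.s e) (fun hs => hs e rfl) ?_, hv⟩
  rw [← he]
  exact .single e

/-- A graph with a unique vertex, which is a sink, is isomorphic to the singleton graph. -/
theorem nonempty_iso_singletonGraph {G : CKGraph} [Unique G.V] (h : G.IsSink default) :
    Nonempty (Iso G singletonGraph) := by
  have : IsEmpty G.E := ⟨fun e => h e (Subsingleton.elim _ _)⟩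
  exact ⟨{  vEquiv := Equiv.ofUnique G.V PUnit
            eEquiv := Equiv.equivOfIsEmpty G.E Empty
            map_r := isEmptyElim
            map_s := isEmptyElim }⟩

/-- A finite graph without loops, without infinite emitters and with exactly one sink is
move-equivalent to the singleton graph. -/
theorem moveEquiv_singletonGraph (G : CKGraph) (hfin : Finite G.V)
    (hnoloop : ∀ v : G.V, ¬ G.HasPath v v)
    (hnoinf : ∀ v : G.V, ¬ G.IsInfiniteEmitter v)
    (hsink : ∃! v : G.V, G.IsSink v) :
    MoveEquiv G singletonGraph := by
  induction hn : Nat.card G.V using Nat.strong_induction_on generalizing G with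
  | _ n ih =>
    obtain ⟨z, hz, huniq⟩ := hsink
    by_cases hall : ∃ v : G.V, ¬ G.IsSink v
    · obtain ⟨v, hsrc, hv⟩ := exists_isSource_not_isSink hnoloop hall
      have hreg : G.Regular v := by
        refine ⟨?_, Set.not_infinite.mp (hnoinf v)⟩
        simpa [IsSink] using hv
      have hfin' : Finite (G.removeSource v hsrc).V := Subtype.finite
      refine .trans (.moveS hfin v hreg hsrc
        ⟨⟨Equiv.refl _, Equiv.refl _, fun _ => rfl, fun _ => rfl⟩⟩)
        (ih _ ?_ (G.removeSource v hsrc) hfin' (fun w hw => hnoloop _ hw.of_removeSource)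
          (fun w => not_isInfiniteEmitter_removeSource (hnoinf w.1)) ?_ rfl)
      · rw [← hn]
        exact Finite.card_subtype_lt (p := fun w => w ≠ v) (x := v) (by simp)
      · refine ⟨⟨z, fun h => hv (h ▸ hz)⟩, (isSink_removeSource_iff _).mpr hz, ?_⟩
        exact fun w hw => Subtype.ext (huniq _ ((isSink_removeSource_iff w).mp hw))
    · push Not at hall
      let _ : Unique G.V := ⟨⟨z⟩, fun w => huniq w (hall w)⟩
      exact .of_iso hfin (nonempty_iso_singletonGraph hz)

end CKGraph

/-- a graph with finitely many vertices, no loops, no infinite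
emitters, exactly one sink, and in which every vertex can reach the sink, is
move-equivalent to the graph with one vertex and no edges. -/
theorem stmt19 (G : CKGraph) (hfin : Finite G.V)
    (hnoloop : ∀ v : G.V, ¬ G.HasPath v v)
    (hnoinf : ∀ v : G.V, ¬ G.IsInfiniteEmitter v)
    (hsink : ∃! v : G.V, G.IsSink v)
    (hreach : ∀ u v : G.V, G.IsSink v → G.Geq u v) :
    CKGraph.MoveEquiv G CKGraph.singletonGraph := by
  exact G.moveEquiv_singletonGraph hfin hnoloop hnoinf hsink
end
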